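/- Let ε₄ ∈ ℝ and define k(x, μ) := x²/2 − ε₄ x ∫_ℝ y dμ(y) for x ∈ ℝ and μ a Borel probability measure on ℝ with finite second moment. Then for all Borel probability measures μ, μ' on ℝ with finite second moments: [∫ k(x,μ') dμ'(x) − ∫ k(x,μ) dμ'(x)] − [∫ k(x,μ') dμ(x) − ∫ k(x,μ) dμ(x)] = −ε₄ (∫ y dμ(y) − ∫ y dμ'(y))². In particular, the generalized Lasry–Lions monotonicity inequality ∫ (k(x,μ') − k(x,μ)) d(μ'−μ)(x) ≥ −l_k (∫ y d(μ−μ')(y))² holds with l_k = ε₄. -/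

import Mathlib

open MeasureTheory

/-- The terminal cost of the non-linear-quadratic example:
`k(x,μ) = x²/2 − ε₄ x ∫ y dμ`. -/
noncomputable def kNLQ (ε₄ : ℝ) (x : ℝ) (μ : Measure ℝ) : ℝ :=
  x ^ 2 / 2 - ε₄ * x * (∫ y, y ∂μ)

/-- For all probability measures `μ, μ'` on `ℝ` with finite second
moments, `∫ (k(x,μ') − k(x,μ)) d(μ'−μ)(x) = −ε₄ (∫ y dμ − ∫ y dμ')²`; in particular the
generalized Lasry–Lions monotonicity inequality holds with `l_k = ε₄`. -/
theorem statement18 (ε₄ : ℝ) :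
    ∀ μ μ' : Measure ℝ, IsProbabilityMeasure μ → IsProbabilityMeasure μ' →
      Integrable (fun y : ℝ => y ^ 2) μ → Integrable (fun y : ℝ => y ^ 2) μ' →
      (((∫ x, kNLQ ε₄ x μ' ∂μ') - ∫ x, kNLQ ε₄ x μ ∂μ') -
          ((∫ x, kNLQ ε₄ x μ' ∂μ) - ∫ x, kNLQ ε₄ x μ ∂μ)
        = -ε₄ * ((∫ y, y ∂μ) - ∫ y, y ∂μ') ^ 2) ∧
      (-ε₄ * ((∫ y, y ∂μ) - ∫ y, y ∂μ') ^ 2 ≤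
        ((∫ x, kNLQ ε₄ x μ' ∂μ') - ∫ x, kNLQ ε₄ x μ ∂μ') -
          ((∫ x, kNLQ ε₄ x μ' ∂μ) - ∫ x, kNLQ ε₄ x μ ∂μ)) := by
  intro μ μ' _ _ hμ hμ'
  have integral_kNLQ (ν η : Measure ℝ) [IsProbabilityMeasure ν]
      (hν : Integrable (fun y : ℝ => y ^ 2) ν) :
      ∫ x, kNLQ ε₄ x η ∂ν = (∫ x, x ^ 2 ∂ν) / 2 - ε₄ * (∫ x, x ∂ν) * ∫ y, y ∂η := by
    have hid : Integrable (fun y : ℝ => y) ν :=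
      ((memLp_two_iff_integrable_sq measurable_id.aestronglyMeasurable).2 hν).integrable
        one_le_two
    simp only [kNLQ]
    rw [integral_sub (hν.div_const 2) ((hid.const_mul ε₄).mul_const _), integral_div,
      integral_mul_const, integral_const_mul]
  rw [integral_kNLQ μ' μ' hμ', integral_kNLQ μ' μ hμ', integral_kNLQ μ μ' hμ,
    integral_kNLQ μ μ hμ]
  exact ⟨by ring, le_of_eq (by ring)⟩
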